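/- For every integer k ≥ 1, m_{k+2} = (2/(k(k+1)))·((k²+1)·m_k − 2·p_k). -/

import Mathlib

open MeasureTheory

/-- The cubic NLS soliton profile. -/
noncomputable def Q (y : ℝ) : ℝ := Real.sqrt 2 / Real.cosh y

/-- `p k = ∫ Q^k cos`. -/
noncomputable def p (k : ℕ) : ℝ := ∫ y : ℝ, (Q y) ^ k * Real.cos y

/-- `m k = ∫ y Q^k sin`. -/
noncomputable def m (k : ℕ) : ℝ := ∫ y : ℝ, y * (Q y) ^ k * Real.sin y

lemma continuous_Q : Continuous Q :=
  continuous_const.div Real.continuous_cosh fun y => (Real.cosh_pos y).ne'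

lemma Q_nonneg (y : ℝ) : 0 ≤ Q y :=
  div_nonneg (Real.sqrt_nonneg 2) (Real.cosh_pos y).le

lemma hasDerivAt_Q (y : ℝ) : HasDerivAt Q (-(Q y * (Real.sinh y / Real.cosh y))) y := by
  have hc := (Real.cosh_pos y).ne'
  refine ((hasDerivAt_const y (Real.sqrt 2)).div (Real.hasDerivAt_cosh y) hc).congr_deriv ?_
  unfold Q
  field_simp
  ring

lemma hasDerivAt_sinh_div_cosh (y : ℝ) :
    HasDerivAt (fun x => Real.sinh x / Real.cosh x) (Q y ^ 2 / 2) y := by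
  have hc := (Real.cosh_pos y).ne'
  refine ((Real.hasDerivAt_sinh y).div (Real.hasDerivAt_cosh y) hc).congr_deriv ?_
  rw [Q, div_pow, Real.sq_sqrt zero_le_two]
  field_simp
  linarith [Real.cosh_sq y]

lemma sinh_div_cosh_sq (y : ℝ) : (Real.sinh y / Real.cosh y) ^ 2 = 1 - Q y ^ 2 / 2 := by
  have hc := (Real.cosh_pos y).ne'
  rw [Q, div_pow, div_pow, Real.sq_sqrt zero_le_two]
  field_simp
  linarith [Real.cosh_sq y]

lemma abs_sinh_div_cosh_le_one (y : ℝ) : |Real.sinh y / Real.cosh y| ≤ 1 := by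
  rw [← sq_le_one_iff_abs_le_one, sinh_div_cosh_sq]
  linarith [sq_nonneg (Q y)]

lemma one_add_abs_mul_one_add_sq_le (y : ℝ) :
    (1 + |y|) * (1 + y ^ 2) ≤ 20 * Real.cosh y := by
  have h1 := Real.pow_div_factorial_le_exp (x := |y|) (abs_nonneg y) 1
  have h2 := Real.pow_div_factorial_le_exp (x := |y|) (abs_nonneg y) 2
  have h3 := Real.pow_div_factorial_le_exp (x := |y|) (abs_nonneg y) 3
  have h0 := Real.one_le_exp (abs_nonneg y)
  norm_num [Nat.factorial] at h1 h2 h3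
  have hc : Real.exp |y| ≤ 2 * Real.cosh y := by
    rw [← Real.cosh_abs, Real.cosh_eq]
    linarith [Real.exp_pos (-|y|)]
  have h4 : |y| * y ^ 2 = |y| ^ 3 := by rw [← sq_abs]; ring
  nlinarith

lemma Q_pow_mul_one_add_abs_le {k : ℕ} (hk : 1 ≤ k) (y : ℝ) :
    Q y ^ k * (1 + |y|) ≤ Real.sqrt 2 ^ k * 20 * (1 + y ^ 2)⁻¹ := by
  have hc := Real.cosh_pos y
  have h1 : Real.cosh y ≤ Real.cosh y ^ k :=
    le_self_pow₀ (Real.one_le_cosh y) (by omega)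
  have h2 : (1 + |y|) / Real.cosh y ^ k ≤ 20 * (1 + y ^ 2)⁻¹ := by
    rw [← div_eq_mul_inv, div_le_div_iff₀ (by positivity) (by positivity)]
    linarith [one_add_abs_mul_one_add_sq_le y]
  calc Q y ^ k * (1 + |y|) = Real.sqrt 2 ^ k * ((1 + |y|) / Real.cosh y ^ k) := by
        rw [Q, div_pow]; ring
    _ ≤ Real.sqrt 2 ^ k * (20 * (1 + y ^ 2)⁻¹) := by gcongr
    _ = _ := by ring

/-- `Q ^ k` times a continuous function of at most linear growth is integrable. -/
lemma integrable_Q_pow_mul {k : ℕ} (hk : 1 ≤ k) {f : ℝ → ℝ} (hf : Continuous f) {C : ℝ}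
    (hC : 0 ≤ C) (hb : ∀ y, |f y| ≤ C * (1 + |y|)) : Integrable fun y => Q y ^ k * f y := by
  refine (integrable_inv_one_add_sq.const_mul (C * (Real.sqrt 2 ^ k * 20))).mono'
    ((continuous_Q.pow k).mul hf).aestronglyMeasurable (Filter.Eventually.of_forall fun y => ?_)
  have hQ := pow_nonneg (Q_nonneg y) k
  rw [Real.norm_eq_abs, abs_mul, abs_of_nonneg hQ]
  calc Q y ^ k * |f y| ≤ Q y ^ k * (C * (1 + |y|)) := by gcongr; exact hb y
    _ = C * (Q y ^ k * (1 + |y|)) := by ring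
    _ ≤ C * (Real.sqrt 2 ^ k * 20 * (1 + y ^ 2)⁻¹) :=
        mul_le_mul_of_nonneg_left (Q_pow_mul_one_add_abs_le hk y) hC
    _ = _ := by ring

lemma integrable_p {k : ℕ} (hk : 1 ≤ k) : Integrable fun y => Q y ^ k * Real.cos y :=
  integrable_Q_pow_mul hk Real.continuous_cos zero_le_one fun y => by
    linarith [Real.abs_cos_le_one y, abs_nonneg y]

lemma abs_mul_le_abs_left {a b : ℝ} (hb : |b| ≤ 1) : |a * b| ≤ |a| := by
  rw [abs_mul]
  exact mul_le_of_le_one_right (abs_nonneg a) hb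

lemma integrable_m {k : ℕ} (hk : 1 ≤ k) : Integrable fun y => y * Q y ^ k * Real.sin y := by
  have h := integrable_Q_pow_mul hk (f := fun y => y * Real.sin y) (by fun_prop) zero_le_one
    fun y => by linarith [abs_mul_le_abs_left (a := y) (Real.abs_sin_le_one y)]
  refine h.congr (Filter.Eventually.of_forall fun y => ?_)
  ring

/-- The boundary term of the double integration by parts of `y sin y (Q ^ k)''`. -/
noncomputable def boundaryTerm (k : ℕ) (y : ℝ) : ℝ :=
  Q y ^ k * (-(k * (y * Real.sin y * (Real.sinh y / Real.cosh y))) - Real.sin y - y * Real.cos y)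

lemma integrable_boundaryTerm {k : ℕ} (hk : 1 ≤ k) : Integrable (boundaryTerm k) := by
  have ht : Continuous fun y => Real.sinh y / Real.cosh y :=
    Real.continuous_sinh.div Real.continuous_cosh fun y => (Real.cosh_pos y).ne'
  refine integrable_Q_pow_mul hk (C := k + 1) (by fun_prop) (by positivity) fun y => ?_
  have hs := Real.abs_sin_le_one y
  have h1 := (abs_mul_le_abs_left (a := y * Real.sin y) (abs_sinh_div_cosh_le_one y)).trans
    (abs_mul_le_abs_left hs)
  have h2 := abs_mul_le_abs_left (a := y) (Real.abs_cos_le_one y)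
  have h3 : |(k : ℝ) * (y * Real.sin y * (Real.sinh y / Real.cosh y))| ≤ k * |y| := by
    rw [abs_mul, Nat.abs_cast]
    gcongr
  have hk0 : (0 : ℝ) ≤ k := k.cast_nonneg
  rw [abs_le] at hs h2 h3 ⊢
  constructor <;> linarith

lemma hasDerivAt_boundaryTerm (k : ℕ) (y : ℝ) :
    HasDerivAt (boundaryTerm k)
      (((k : ℝ) ^ 2 + 1) * (y * Q y ^ k * Real.sin y)
        - k * (k + 1) / 2 * (y * Q y ^ (k + 2) * Real.sin y)
        - 2 * (Q y ^ k * Real.cos y)) y := by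
  have hsin := Real.hasDerivAt_sin y
  have hQ : HasDerivAt (fun x => Q x ^ k) (-(k * Q y ^ k * (Real.sinh y / Real.cosh y))) y := by
    refine ((hasDerivAt_Q y).pow k).congr_deriv ?_
    rcases k with _ | k
    · simp
    · simp only [Nat.add_sub_cancel]
      ring
  have h := hQ.mul ((((((hasDerivAt_id y).mul hsin).mul
    (hasDerivAt_sinh_div_cosh y)).const_mul (k : ℝ)).neg.sub hsin).sub
      ((hasDerivAt_id y).mul (Real.hasDerivAt_cos y)))
  refine h.congr_deriv ?_
  simp only [id, Pi.mul_apply, Pi.sub_apply, Pi.neg_apply]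
  linear_combination (k : ℝ) ^ 2 * y * Q y ^ k * Real.sin y * sinh_div_cosh_sq y

theorem stmt13 :
    ∀ k : ℕ, 1 ≤ k →
      m (k + 2) = (2 / ((k : ℝ) * ((k : ℝ) + 1))) * (((k : ℝ) ^ 2 + 1) * m k - 2 * p k) := by
  intro k hk
  have hm := (integrable_m hk).const_mul ((k : ℝ) ^ 2 + 1)
  have hm2 := (integrable_m (k := k + 2) (by omega)).const_mul ((k : ℝ) * (k + 1) / 2)
  have hp := (integrable_p hk).const_mul 2
  have h := integral_eq_zero_of_hasDerivAt_of_integrable (hasDerivAt_boundaryTerm k)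
    ((hm.sub hm2).sub hp) (integrable_boundaryTerm hk)
  have hsub := integral_sub (hm.sub hm2) hp
  simp only [Pi.sub_apply] at hsub
  rw [hsub, integral_sub hm hm2] at h
  simp only [integral_const_mul] at h
  change ((k : ℝ) ^ 2 + 1) * m k - k * (k + 1) / 2 * m (k + 2) - 2 * p k = 0 at h
  have hk0 : (k : ℝ) ≠ 0 := by positivity
  have hk1 : (k : ℝ) + 1 ≠ 0 := by positivity
  field_simp
  linarith
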